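/- Let λ ∈ ℝⁿ satisfy λ_1 ≥ λ_2 ≥ ⋯ ≥ λ_n ≥ 0 and λ_1 > 0. Then κ_λ(x) = Σ_{i=1}^n λ_i |x|_i^↓ is a norm on ℝⁿ: κ_λ(x) ≥ 0 with equality if and only if x = 0, κ_λ(c·x) = |c|·κ_λ(x) for every scalar c, and κ_λ(x + y) ≤ κ_λ(x) + κ_λ(y) for all x, y ∈ ℝⁿ. -/

import Mathlib

open Matrix

/-- `absDown x` is the vector of the absolute values of the entries of `x`
arranged in non-increasing order, i.e. `|x|^↓`. -/
noncomputable def absDown {n : ℕ} (x : Fin n → ℝ) : Fin n → ℝ :=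
  fun i => |x (Tuple.sort (fun k => -|x k|) i)|

/-- The decreasing weighted sorted ℓ₁ (DWSL1) function `κ_λ(x) = ∑ λ_i |x|_i^↓`. -/
noncomputable def kappa {n : ℕ} (lam x : Fin n → ℝ) : ℝ :=
  ∑ i, lam i * absDown x i

/-- A signed permutation matrix: exactly one nonzero entry in each row and
each column, and every entry is `0`, `1` or `-1`. -/
def IsSignedPerm {n : ℕ} (π : Matrix (Fin n) (Fin n) ℝ) : Prop :=
  (∀ i, ∃! j, π i j ≠ 0) ∧ (∀ j, ∃! i, π i j ≠ 0) ∧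
    ∀ i j, π i j = 0 ∨ π i j = 1 ∨ π i j = -1

/-- The matrix `B` with `(Bx)_i = x_i - x_{i+1}` for `i < n-1` and `(Bx)_{n-1} = x_{n-1}`. -/
def Bmat (n : ℕ) : Matrix (Fin n) (Fin n) ℝ :=
  Matrix.of fun i j => if j = i then 1 else if (j : ℕ) = (i : ℕ) + 1 then -1 else 0

/-- `B_Γ`: the submatrix of `B` consisting of the rows indexed by `Γ`. -/
def Brows {n : ℕ} (Γ : Finset (Fin n)) : Matrix {i // i ∈ Γ} (Fin n) ℝ :=
  Matrix.of fun i j => Bmat n i.1 j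

/-- `P = Iₙ - B_Γᵀ (B_Γ B_Γᵀ)⁻¹ B_Γ`. -/
noncomputable def Pmat {n : ℕ} (Γ : Finset (Fin n)) : Matrix (Fin n) (Fin n) ℝ :=
  1 - (Brows Γ)ᵀ * (Brows Γ * (Brows Γ)ᵀ)⁻¹ * Brows Γ

/-- The Euclidean norm on `Fin n → ℝ`. -/
noncomputable def eucNorm {n : ℕ} (x : Fin n → ℝ) : ℝ := Real.sqrt (∑ i, (x i) ^ 2)

/-- Membership in the set `C_λ = {z : ∑_{j ≤ i} |z|_j^↓ ≤ ∑_{j ≤ i} λ_j for all i}`. -/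
def memC {n : ℕ} (lam z : Fin n → ℝ) : Prop :=
  ∀ i : Fin n, ∑ j ∈ Finset.Iic i, absDown z j ≤ ∑ j ∈ Finset.Iic i, lam j

theorem antitone_absDown {n : ℕ} (x : Fin n → ℝ) : Antitone (absDown x) := fun _ _ hij =>
  neg_le_neg_iff.mp (Tuple.monotone_sort (fun k => -|x k|) hij)

theorem absDown_nonneg {n : ℕ} (x : Fin n → ℝ) (i : Fin n) : 0 ≤ absDown x i :=
  abs_nonneg _

/-- Rearrangement inequality: `κ_λ(x)` dominates every weighted sum of the entries of `|x|`. -/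
theorem sum_mul_abs_comp_perm_le_kappa {n : ℕ} {lam : Fin n → ℝ} (hmono : Antitone lam)
    (x : Fin n → ℝ) (σ : Equiv.Perm (Fin n)) :
    ∑ i, lam i * |x (σ i)| ≤ kappa lam x := by
  have h := (hmono.monovary (antitone_absDown x)).sum_mul_comp_perm_le_sum_mul
    (σ := σ.trans (Tuple.sort fun k => -|x k|).symm)
  simpa [kappa, absDown] using h

theorem kappa_nonneg {n : ℕ} {lam : Fin n → ℝ} (hpos : ∀ i, 0 ≤ lam i) (x : Fin n → ℝ) :
    0 ≤ kappa lam x :=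
  Finset.sum_nonneg fun i _ => mul_nonneg (hpos i) (absDown_nonneg x i)

theorem kappa_eq_zero_iff {n : ℕ} (hn : 0 < n) {lam : Fin n → ℝ} (hpos : ∀ i, 0 ≤ lam i)
    (hlam1 : 0 < lam ⟨0, hn⟩) (x : Fin n → ℝ) : kappa lam x = 0 ↔ x = 0 := by
  refine ⟨fun h => ?_, fun h => by simp [h, kappa, absDown]⟩
  have hterm := (Finset.sum_eq_zero_iff_of_nonneg
    fun i _ => mul_nonneg (hpos i) (absDown_nonneg x i)).mp h ⟨0, hn⟩ (Finset.mem_univ _)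
  have htop : absDown x ⟨0, hn⟩ = 0 := (mul_eq_zero.mp hterm).resolve_left hlam1.ne'
  funext k
  have hk := antitone_absDown x
    (show ⟨0, hn⟩ ≤ (Tuple.sort fun k => -|x k|).symm k from Nat.zero_le _)
  rw [htop] at hk
  simpa [absDown] using hk

theorem kappa_smul {n : ℕ} {lam : Fin n → ℝ} (hmono : Antitone lam) (c : ℝ) (x : Fin n → ℝ) :
    kappa lam (c • x) = |c| * kappa lam x := by
  have hsum (σ : Equiv.Perm (Fin n)) :
      ∑ i, lam i * |(c • x) (σ i)| = |c| * ∑ i, lam i * |x (σ i)| := by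
    simp only [Pi.smul_apply, smul_eq_mul, abs_mul, Finset.mul_sum, mul_left_comm]
  apply le_antisymm
  · exact (hsum _).trans_le (mul_le_mul_of_nonneg_left
      (sum_mul_abs_comp_perm_le_kappa hmono x _) (abs_nonneg c))
  · exact (hsum _).symm.trans_le (sum_mul_abs_comp_perm_le_kappa hmono (c • x) _)

theorem kappa_add_le {n : ℕ} {lam : Fin n → ℝ} (hmono : Antitone lam) (hpos : ∀ i, 0 ≤ lam i)
    (x y : Fin n → ℝ) : kappa lam (x + y) ≤ kappa lam x + kappa lam y := by
  set σ := Tuple.sort fun k => -|(x + y) k|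
  calc kappa lam (x + y) ≤ ∑ i, (lam i * |x (σ i)| + lam i * |y (σ i)|) :=
        Finset.sum_le_sum fun i _ => by
          rw [← mul_add]
          exact mul_le_mul_of_nonneg_left (abs_add_le _ _) (hpos i)
    _ = ∑ i, lam i * |x (σ i)| + ∑ i, lam i * |y (σ i)| := Finset.sum_add_distrib
    _ ≤ kappa lam x + kappa lam y :=
        add_le_add (sum_mul_abs_comp_perm_le_kappa hmono x σ)
          (sum_mul_abs_comp_perm_le_kappa hmono y σ)

/-- If `λ₁ ≥ ⋯ ≥ λₙ ≥ 0` and `λ₁ > 0`, then `κ_λ` is a norm on `ℝⁿ`. -/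
theorem stmt2 {n : ℕ} (hn : 0 < n) (lam : Fin n → ℝ) (hmono : Antitone lam)
    (hpos : ∀ i, 0 ≤ lam i) (hlam1 : 0 < lam ⟨0, hn⟩) :
    (∀ x : Fin n → ℝ, 0 ≤ kappa lam x) ∧
    (∀ x : Fin n → ℝ, kappa lam x = 0 ↔ x = 0) ∧
    (∀ (c : ℝ) (x : Fin n → ℝ), kappa lam (c • x) = |c| * kappa lam x) ∧
    (∀ x y : Fin n → ℝ, kappa lam (x + y) ≤ kappa lam x + kappa lam y) := by
  exact ⟨kappa_nonneg hpos, kappa_eq_zero_iff hn hpos hlam1, kappa_smul hmono,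
    kappa_add_le hmono hpos⟩
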